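/- arXiv:1209.2100 — 3 statements merged into one kernel-verified Lean document; each statement's English description precedes it below -/
import Mathlib

section
/- For every d ≥ 3, the ring ℂ[x₁, …, x_d, y₁, …, y_d]/(x₁y₁ + x₂y₂ + ⋯ + x_dy_d − 1) is a unique factorization domain. -/
/-- Nagata-type criterion. -/
theorem nagata_aux {A B : Type*} [CommRing A] [IsDomain A] [IsNoetherianRing A]
    [CommRing B] [IsDomain B] [UniqueFactorizationMonoid B] (f : B →+* A)
    (hf : Function.Injective f) (x : B) (hx : Prime (f x))
    (hs : ∀ a : A, ∃ n : ℕ, ∃ b : B, f b = f x ^ n * a) : UniqueFactorizationMonoid A := by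
  rw [UniqueFactorizationMonoid.iff_exists_prime_mem_of_isPrime]
  intro P hP hPp
  by_cases hxP : f x ∈ P
  · exact ⟨_, hxP, hx⟩
  obtain ⟨p, hpP, hp0⟩ := Submodule.exists_mem_ne_zero_of_ne_bot hP
  have hne : P.comap f ≠ ⊥ := by
    obtain ⟨n, b, hb⟩ := hs p
    intro h
    have hbm : b ∈ P.comap f := by
      rw [Ideal.mem_comap, hb]
      exact P.mul_mem_left _ hpP
    rw [h, Ideal.mem_bot] at hbm
    rw [hbm, map_zero] at hb
    exact mul_ne_zero (pow_ne_zero _ hx.ne_zero) hp0 hb.symm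
  have hcp : (P.comap f).IsPrime := inferInstance
  obtain ⟨q, hqP, hq⟩ := hcp.exists_mem_prime_of_ne_bot hne
  have hq0 : f q ≠ 0 := fun h => hq.ne_zero (hf (by rw [h, map_zero]))
  obtain ⟨k, q', hq'x, hqq'⟩ := WfDvdMonoid.max_power_factor hq0 hx.irreducible
  have hq'P : q' ∈ P := by
    have h1 : f x ^ k * q' ∈ P := hqq' ▸ hqP
    rcases hPp.mem_or_mem h1 with h | h
    · exact absurd (hPp.mem_of_pow_mem _ h) hxP
    · exact h
  -- removing powers of `x`
  have cancel : ∀ (m : ℕ) (a : A), q' ∣ f x ^ m * a → q' ∣ a := by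
    intro m
    induction m with
    | zero => intro a h; simpa using h
    | succ m ih =>
      intro a h
      apply ih
      obtain ⟨c, hc⟩ := h
      have h1 : f x ∣ q' * c := ⟨f x ^ m * a, by rw [← hc]; ring⟩
      rcases hx.dvd_or_dvd h1 with h | ⟨e, rfl⟩
      · exact absurd h hq'x
      · refine ⟨e, mul_left_cancel₀ hx.ne_zero ?_⟩
        linear_combination hc
  have key : ∀ (a : A) (n : ℕ) (b : B), f b = f x ^ n * a → q ∣ b → q' ∣ a := by
    rintro a n b hb ⟨c, rfl⟩
    apply cancel n
    rw [← hb, map_mul, hqq']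
    exact ⟨f x ^ k * f c, by ring⟩
  refine ⟨q', hq'P, fun h => hq0 (by rw [hqq', h, mul_zero]),
    fun h => hPp.ne_top (P.eq_top_of_isUnit_mem hq'P h), ?_⟩
  rintro a b ⟨c, hc⟩
  obtain ⟨n, a', ha'⟩ := hs a
  obtain ⟨m, b', hb'⟩ := hs b
  obtain ⟨l, c', hc'⟩ := hs c
  have h1 : q ∣ x ^ l * x ^ k * a' * b' := by
    refine ⟨c' * x ^ n * x ^ m, hf ?_⟩
    simp only [map_mul, map_pow, ha', hb', hc', hqq']
    linear_combination (f x ^ l * f x ^ k * f x ^ n * f x ^ m) * hc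
  rcases hq.dvd_or_dvd h1 with h | h
  · left
    refine key a (l + k + n) (x ^ l * x ^ k * a') ?_ h
    simp only [map_mul, map_pow, ha']
    ring
  · right
    exact key b m b' hb' h

open MvPolynomial in
theorem irr_aux (m : ℕ) : Prime ((∑ i : Fin (m + 1), X (Sum.inl i.succ) * X (Sum.inr i.succ)) - 1 :
    MvPolynomial (Fin (m + 2) ⊕ Fin (m + 2)) ℂ) := by
  apply Irreducible.prime
  rw [Fin.sum_univ_succ, add_sub_assoc]
  apply irreducible_mul_X_add
  · exact X_ne_zero _
  · simp
  · intro h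
    rcases Finset.mem_union.1 (vars_sub_subset _ h) with h | h
    · obtain ⟨i, -, hi⟩ := Finset.mem_biUnion.1 (vars_sum_subset _ _ h)
      have := vars_mul _ _ hi
      simp [Fin.ext_iff] at this
    · simp at h
  · rw [(X_prime (R := ℂ)).irreducible.isRelPrime_iff_not_dvd]
    intro h
    have := map_dvd (aeval (fun _ => (0 : ℂ))) h
    simp at this

open MvPolynomial in
theorem prime_aux (m : ℕ) (F : MvPolynomial (Fin (m + 2) ⊕ Fin (m + 2)) ℂ)
    (hFdef : F = (∑ i : Fin (m + 2), X (Sum.inl i) * X (Sum.inr i)) - 1)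
    (x0 : MvPolynomial (Fin (m + 2) ⊕ Fin (m + 2)) ℂ ⧸ Ideal.span {F})
    (hx0 : x0 = Ideal.Quotient.mk _ (X (Sum.inl 0))) (hne : x0 ≠ 0) : Prime x0 := by
  classical
  have hg := irr_aux m
  set g := ((∑ i : Fin (m + 1), X (Sum.inl i.succ) * X (Sum.inr i.succ)) - 1 :
    MvPolynomial (Fin (m + 2) ⊕ Fin (m + 2)) ℂ) with hgdef
  have hF : F = X (Sum.inl 0) * X (Sum.inr 0) + g := by
    rw [hFdef, hgdef, Fin.sum_univ_succ, add_sub_assoc]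
  let e : MvPolynomial (Fin (m + 2) ⊕ Fin (m + 2)) ℂ →ₐ[ℂ]
      MvPolynomial (Fin (m + 2) ⊕ Fin (m + 2)) ℂ :=
    aeval (fun s => if s = Sum.inl 0 then 0 else X s)
  have heX : e (X (Sum.inl 0)) = 0 := by simp [e]
  have heg : e g = g := by
    simp [e, hgdef, Fin.succ_ne_zero]
  have heF : e F = g := by
    rw [hF, map_add, map_mul, heX, heg]; ring
  have hsub : ∀ a, X (Sum.inl 0) ∣ a - e a := by
    intro a
    induction a using MvPolynomial.induction_on with
    | C r => simp [e]
    | add p q hp hq =>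
      rw [map_add]
      have := dvd_add hp hq
      convert this using 1
      ring
    | mul_X p s hp =>
      rw [map_mul]
      by_cases hs : s = Sum.inl 0
      · subst hs
        rw [heX]; simp
      · have : e (X s) = X s := by simp [e, hs]
        rw [this, ← sub_mul]
        exact Dvd.dvd.mul_right hp _
  have dvd_imp : ∀ a, x0 ∣ Ideal.Quotient.mk (Ideal.span {F}) a → g ∣ e a := by
    rintro a ⟨c, hc⟩
    obtain ⟨c, rfl⟩ := Ideal.Quotient.mk_surjective c
    rw [hx0, ← map_mul, Ideal.Quotient.eq, Ideal.mem_span_singleton] at hc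
    have := map_dvd e hc
    rwa [heF, map_sub, map_mul, heX, zero_mul, sub_zero] at this
  have imp_dvd : ∀ a, g ∣ e a → x0 ∣ Ideal.Quotient.mk (Ideal.span {F}) a := by
    rintro a ⟨h, hh⟩
    obtain ⟨k, hk⟩ := hsub a
    refine ⟨Ideal.Quotient.mk _ (k - X (Sum.inr 0) * h), ?_⟩
    rw [hx0, ← map_mul, Ideal.Quotient.eq, Ideal.mem_span_singleton]
    refine ⟨h, ?_⟩
    rw [hF]
    linear_combination hk + hh
  refine ⟨hne, fun hu => ?_, fun a b hab => ?_⟩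
  · have := dvd_imp 1 (hu.dvd)
    rw [map_one] at this
    exact hg.not_isUnit (isUnit_of_dvd_one this)
  · obtain ⟨a, rfl⟩ := Ideal.Quotient.mk_surjective a
    obtain ⟨b, rfl⟩ := Ideal.Quotient.mk_surjective b
    rw [← map_mul] at hab
    have := dvd_imp _ hab
    rw [map_mul] at this
    exact (hg.dvd_or_dvd this).imp (imp_dvd a) (imp_dvd b)

/-- All variables. -/
abbrev Sig (m : ℕ) : Type := Fin (m + 2) ⊕ Fin (m + 2)

/-- All variables but one. -/
abbrev Tau (m : ℕ) : Type := {s : Sig m // s ≠ Sum.inr 0}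

/-- The polynomial subring. -/
noncomputable abbrev RB (m : ℕ) : Type := MvPolynomial (Tau m) ℂ

/-- Its fraction field. -/
noncomputable abbrev RK (m : ℕ) : Type := FractionRing (RB m)

open MvPolynomial in
theorem main_aux (m : ℕ)
    [IsDomain (MvPolynomial (Fin (m + 2) ⊕ Fin (m + 2)) ℂ ⧸
      Ideal.span {((∑ i : Fin (m + 2), X (Sum.inl i) * X (Sum.inr i)) - 1 :
        MvPolynomial (Fin (m + 2) ⊕ Fin (m + 2)) ℂ)})] :
    UniqueFactorizationMonoid (MvPolynomial (Fin (m + 2) ⊕ Fin (m + 2)) ℂ ⧸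
      Ideal.span {((∑ i : Fin (m + 2), X (Sum.inl i) * X (Sum.inr i)) - 1 :
        MvPolynomial (Fin (m + 2) ⊕ Fin (m + 2)) ℂ)}) := by
  classical
  let I : Ideal (MvPolynomial (Sig m) ℂ) :=
    Ideal.span {((∑ i : Fin (m + 2), X (Sum.inl i) * X (Sum.inr i)) - 1)}
  let f : (RB m) →+* (MvPolynomial (Sig m) ℂ ⧸ I) :=
    (Ideal.Quotient.mk I).comp (rename (Subtype.val : (Tau m) → (Sig m))).toRingHom
  let xB : (RB m) := X ⟨Sum.inl 0, by simp⟩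
  have hxK : algebraMap (RB m) (RK m) xB ≠ 0 := by
    intro h
    exact X_ne_zero _ ((FaithfulSMul.algebraMap_injective (RB m) (RK m)) (by rw [h, map_zero]))
  let gB : (RB m) := (∑ i : Fin (m + 1), X ⟨Sum.inl i.succ, by simp⟩ *
    X ⟨Sum.inr i.succ, by simp [Fin.succ_ne_zero]⟩)
  let v : (Sig m) → (RK m) := fun s => if h : s ≠ Sum.inr 0 then algebraMap (RB m) (RK m) (X ⟨s, h⟩) else
    (1 - algebraMap (RB m) (RK m) gB) / algebraMap (RB m) (RK m) xB
  let φ : MvPolynomial (Sig m) ℂ →ₐ[ℂ] (RK m) := aeval v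
  have hφF : φ ((∑ i : Fin (m + 2), X (Sum.inl i) * X (Sum.inr i)) - 1) = 0 := by
    have h1 : φ (∑ i : Fin (m + 1), X (Sum.inl i.succ) * X (Sum.inr i.succ)) =
        algebraMap (RB m) (RK m) gB := by
      simp [φ, v, gB, Fin.succ_ne_zero]
    have h2 : φ (X (Sum.inl 0)) = algebraMap (RB m) (RK m) xB := by
      simp [φ, v, xB]
    have h3 : φ (X (Sum.inr 0)) = (1 - algebraMap (RB m) (RK m) gB) / algebraMap (RB m) (RK m) xB := by
      simp [φ, v]
    rw [Fin.sum_univ_succ, map_sub, map_add, map_mul, h1, h2, h3, map_one, mul_div_cancel₀ _ hxK]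
    ring
  have hcomp : ∀ b : (RB m), φ (rename (Subtype.val : (Tau m) → (Sig m)) b) = algebraMap (RB m) (RK m) b := by
    intro b
    have : φ.comp (rename (Subtype.val : (Tau m) → (Sig m))) = Algebra.algHom ℂ (RB m) (RK m) := by
      apply MvPolynomial.algHom_ext
      rintro ⟨s, hs⟩
      simp [φ, v, hs]
      rfl
    exact DFunLike.congr_fun this b
  have hf : Function.Injective f := by
    rw [injective_iff_map_eq_zero]
    intro b hb
    have hb' : rename (Subtype.val : (Tau m) → (Sig m)) b ∈ I := Ideal.Quotient.eq_zero_iff_mem.1 hb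
    obtain ⟨c, hc⟩ := Ideal.mem_span_singleton.1 hb'
    have := hcomp b
    rw [hc, map_mul, hφF, zero_mul] at this
    exact (FaithfulSMul.algebraMap_injective (RB m) (RK m)) (by rw [← this, map_zero])
  have hfx : f xB = Ideal.Quotient.mk I (X (Sum.inl 0)) := by
    simp [f, xB]
  have hx : Prime (f xB) := by
    apply prime_aux m _ rfl _ hfx
    intro h
    exact X_ne_zero _ (hf (by rw [map_zero]; exact h))
  have hs : ∀ a : MvPolynomial (Sig m) ℂ ⧸ I, ∃ n : ℕ, ∃ b : (RB m), f b = f xB ^ n * a := by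
    intro a
    obtain ⟨a, rfl⟩ := Ideal.Quotient.mk_surjective a
    induction a using MvPolynomial.induction_on with
    | C r => exact ⟨0, C r, by simp [f]⟩
    | add p q hp hq =>
      obtain ⟨n, b, hb⟩ := hp
      obtain ⟨k, c, hc⟩ := hq
      refine ⟨n + k, xB ^ k * b + xB ^ n * c, ?_⟩
      simp only [map_add, map_mul, map_pow, hb, hc]
      ring
    | mul_X p s hp =>
      obtain ⟨n, b, hb⟩ := hp
      by_cases h : s = Sum.inr 0
      · subst h
        refine ⟨n + 1, b * (1 - gB), ?_⟩
        have h1 : f (1 - gB) = f xB * Ideal.Quotient.mk I (X (Sum.inr 0)) := by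
          rw [hfx, ← map_mul]
          apply Ideal.Quotient.eq.2
          apply Ideal.mem_span_singleton.2
          refine ⟨-1, ?_⟩
          rw [Fin.sum_univ_succ]
          simp [gB]
          ring
        rw [map_mul, h1, hb, map_mul]
        ring
      · refine ⟨n, b * X ⟨s, h⟩, ?_⟩
        have h1 : f (X ⟨s, h⟩) = Ideal.Quotient.mk I (X s) := by simp [f]
        rw [map_mul, h1, hb, map_mul]
        ring
  exact nagata_aux f hf xB hx hs

open MvPolynomial in
/-- For every `d ≥ 3`, the coordinate ring
`ℂ[x₁,…,x_d,y₁,…,y_d]/(x₁y₁ + ⋯ + x_dy_d - 1)` of `SL(d)/SL(d-1)` is a unique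
factorization domain. (The quotient is a domain since the relation is irreducible;
this is recorded as an instance hypothesis.) -/
theorem stmt_6 (d : ℕ) (hd : 3 ≤ d)
    [IsDomain (MvPolynomial (Fin d ⊕ Fin d) ℂ ⧸
      Ideal.span {((∑ i : Fin d, X (Sum.inl i) * X (Sum.inr i)) - 1 :
        MvPolynomial (Fin d ⊕ Fin d) ℂ)})] :
    UniqueFactorizationMonoid (MvPolynomial (Fin d ⊕ Fin d) ℂ ⧸
      Ideal.span {((∑ i : Fin d, X (Sum.inl i) * X (Sum.inr i)) - 1 :
        MvPolynomial (Fin d ⊕ Fin d) ℂ)}) := by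
  obtain ⟨m, rfl⟩ : ∃ m, d = m + 2 := ⟨d - 2, by omega⟩
  exact main_aux m
end

section
/- For d ≥ 3 and nonnegative integers a₁, …, a_n (not all arbitrary — any choice is allowed), the ring ℂ[x₁,…,x_d, y₁,…,y_d, w₁,…,w_n]/(x₁y₁ + ⋯ + x_dy_d − w₁^{a₁}⋯w_n^{a_n}) is a unique factorization domain. -/
open MvPolynomial in
/-- Every polynomial becomes, after multiplication by a power of `X s` and modulo
`X s * X t + g`, a polynomial not involving `X t`. -/
lemma aux_clear {σ : Type*} (s t : σ) (hst : s ≠ t)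
    (g' : MvPolynomial {i : σ // i ≠ t} ℂ) (p : MvPolynomial σ ℂ) :
    ∃ (n : ℕ) (q : MvPolynomial {i : σ // i ≠ t} ℂ),
      X s ^ n * p - rename Subtype.val q ∈
        Ideal.span {(X s * X t + rename Subtype.val g' : MvPolynomial σ ℂ)} := by
  induction p using MvPolynomial.induction_on with
  | C c => exact ⟨0, C c, by simp⟩
  | add p₁ p₂ h₁ h₂ =>
    obtain ⟨n₁, q₁, h₁⟩ := h₁
    obtain ⟨n₂, q₂, h₂⟩ := h₂
    refine ⟨n₁ + n₂, X ⟨s, hst⟩ ^ n₂ * q₁ + X ⟨s, hst⟩ ^ n₁ * q₂, ?_⟩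
    have := Ideal.add_mem _ (Ideal.mul_mem_left _ (X s ^ n₂) h₁)
      (Ideal.mul_mem_left _ (X s ^ n₁) h₂)
    convert this using 1
    simp only [map_add, map_mul, map_pow, rename_X]
    ring
  | mul_X p i h =>
    obtain ⟨n, q, h⟩ := h
    by_cases hi : i = t
    · subst hi
      refine ⟨n + 1, - g' * q, ?_⟩
      have := Ideal.add_mem _ (Ideal.mul_mem_left _ (X s * X i) h)
        (Ideal.mul_mem_left _ (rename Subtype.val q)
          (Ideal.mem_span_singleton_self (X s * X i + rename Subtype.val g' : MvPolynomial σ ℂ)))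
      convert this using 1
      simp only [map_mul, map_neg]
      ring
    · refine ⟨n, q * X ⟨i, hi⟩, ?_⟩
      have := Ideal.mul_mem_left _ (X i) h
      convert this using 1
      simp only [map_mul, rename_X]
      ring

open MvPolynomial in
lemma aux_prime {σ : Type*} [DecidableEq σ] (s : σ) (f g : MvPolynomial σ ℂ)
    (hfg : X s ∣ f - g) (hg : Prime g)
    (hgs : aeval (fun i => if i = s then 0 else X i : σ → MvPolynomial σ ℂ) g = g)
    (h0 : Ideal.Quotient.mk (Ideal.span {f}) (X s) ≠ 0) :
    Prime (Ideal.Quotient.mk (Ideal.span {f}) (X s)) := by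
  set ψ : MvPolynomial σ ℂ →ₐ[ℂ] MvPolynomial σ ℂ :=
    aeval (fun i => if i = s then 0 else X i : σ → MvPolynomial σ ℂ) with hψ
  have hψs : ψ (X s) = 0 := by simp [hψ]
  have hmod : ∀ p, X s ∣ p - ψ p := by
    intro p
    induction p using MvPolynomial.induction_on with
    | C c => simp [hψ]
    | add p q hp hq =>
      have := dvd_add hp hq
      convert this using 1
      rw [map_add]; ring
    | mul_X p i hp =>
      rw [map_mul]
      by_cases hi : i = s
      · subst hi; rw [hψs]; simp
      · have : ψ (X i) = X i := by simp [hψ, hi]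
        rw [this, ← sub_mul]
        exact Dvd.dvd.mul_right hp _
  have hψf : ψ f = g := by
    obtain ⟨c, hc⟩ := hfg
    have : f = g + X s * c := by rw [← hc]; ring
    rw [this, map_add, map_mul, hψs, hgs]; ring
  have key : ∀ p, Ideal.Quotient.mk (Ideal.span {f}) (X s) ∣ Ideal.Quotient.mk (Ideal.span {f}) p ↔
      g ∣ ψ p := by
    intro p
    constructor
    · rintro ⟨c, hc⟩
      obtain ⟨c, rfl⟩ := Ideal.Quotient.mk_surjective c
      rw [← map_mul, Ideal.Quotient.eq, Ideal.mem_span_singleton] at hc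
      obtain ⟨e, he⟩ := hc
      refine ⟨ψ e, ?_⟩
      have : p = X s * c + f * e := by rw [← he]; ring
      rw [this, map_add, map_mul, map_mul, hψs, hψf]; ring
    · rintro ⟨c, hc⟩
      obtain ⟨e, he⟩ := hmod p
      obtain ⟨k, hk⟩ := hfg
      refine ⟨Ideal.Quotient.mk _ (e - k * c), ?_⟩
      rw [← map_mul, Ideal.Quotient.eq, Ideal.mem_span_singleton]
      refine ⟨c, ?_⟩
      linear_combination he + hc - c * hk
  refine ⟨h0, ?_, ?_⟩
  · intro hu
    have h1 := (key 1).1 (hu.dvd)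
    rw [map_one] at h1
    exact hg.not_isUnit (isUnit_of_dvd_one h1)
  · intro a b hab
    obtain ⟨a, rfl⟩ := Ideal.Quotient.mk_surjective a
    obtain ⟨b, rfl⟩ := Ideal.Quotient.mk_surjective b
    rw [← map_mul, key, map_mul] at hab
    rw [key, key]
    exact hg.dvd_or_dvd hab

open MvPolynomial in
theorem aux_ufd {σ : Type*} [Finite σ] [DecidableEq σ] (s t : σ) (hst : s ≠ t)
    (f g : MvPolynomial σ ℂ) (hf : f = X s * X t + g) (hg : Irreducible g)
    (hgt : g ∈ supported ℂ {i : σ | i ≠ t})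
    (hgs : aeval (fun i => if i = s then 0 else X i : σ → MvPolynomial σ ℂ) g = g)
    [IsDomain (MvPolynomial σ ℂ ⧸ Ideal.span {f})] :
    UniqueFactorizationMonoid (MvPolynomial σ ℂ ⧸ Ideal.span {f}) := by
  rw [supported_eq_range_rename] at hgt
  obtain ⟨g', hg'⟩ := hgt
  change MvPolynomial {i : σ // i ≠ t} ℂ at g'
  change rename (Subtype.val : {i : σ // i ≠ t} → σ) g' = g at hg'
  let A := MvPolynomial {i : σ // i ≠ t} ℂ
  let x : A := X ⟨s, hst⟩
  let L := Localization.Away x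
  have hx0 : x ≠ 0 := X_ne_zero _
  have hinj : Function.Injective (algebraMap A L) :=
    IsLocalization.injective L (powers_le_nonZeroDivisors_of_noZeroDivisors hx0)
  have hxu : IsUnit (algebraMap A L x) := IsLocalization.Away.algebraMap_isUnit x
  obtain ⟨u, hu⟩ := hxu
  let Φ : MvPolynomial σ ℂ →ₐ[ℂ] L := aeval (fun i => if h : i = t then
    - algebraMap A L g' * (↑u⁻¹ : L) else algebraMap A L (X ⟨i, h⟩))
  have hΦt : Φ (X t) = - algebraMap A L g' * (↑u⁻¹ : L) := by simp [Φ]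
  have hΦr : ∀ q : A, Φ (rename Subtype.val q) = algebraMap A L q := by
    intro q
    have : Φ.comp (rename Subtype.val) = IsScalarTower.toAlgHom ℂ A L := by
      apply MvPolynomial.algHom_ext
      rintro ⟨i, hi⟩
      simp [Φ, hi]
      rfl
    exact DFunLike.congr_fun this q
  have hΦs : Φ (X s) = u := by
    have := hΦr x
    rw [hu, ← this]; simp [x]
  have hΦf : Φ f = 0 := by
    rw [hf, ← hg', map_add, map_mul, hΦr, hΦs, hΦt]
    linear_combination (- algebraMap A L g') * u.mul_inv
  let φ : MvPolynomial σ ℂ ⧸ Ideal.span {f} →+* L :=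
    Ideal.Quotient.lift (Ideal.span {f}) Φ.toRingHom (by
      intro a ha
      obtain ⟨c, rfl⟩ := Ideal.mem_span_singleton.1 ha
      change Φ (f * c) = 0
      rw [map_mul, hΦf, zero_mul])
  have hφ : ∀ p, φ (Ideal.Quotient.mk _ p) = Φ p := fun p => rfl
  have hL : Nontrivial L := hinj.nontrivial
  have hs0 : Ideal.Quotient.mk (Ideal.span {f}) (X s) ≠ 0 := by
    intro h
    have := hφ (X s)
    rw [h, map_zero, hΦs] at this
    exact u.ne_zero this.symm
  have hp : Prime (Ideal.Quotient.mk (Ideal.span {f}) (X s)) :=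
    aux_prime s f g ⟨X t, by rw [hf]; ring⟩ hg.prime hgs hs0
  letI : Algebra (MvPolynomial σ ℂ ⧸ Ideal.span {f}) L := φ.toAlgebra
  have halg : ∀ r, algebraMap (MvPolynomial σ ℂ ⧸ Ideal.span {f}) L r = φ r := fun r => rfl
  have hloc : IsLocalization.Away (Ideal.Quotient.mk (Ideal.span {f}) (X s)) L := by
    refine (isLocalization_iff _ _).2 ⟨?_, ?_, ?_⟩
    · rintro ⟨_, n, rfl⟩
      simp only [map_pow, halg, hφ, hΦs]
      exact u.isUnit.pow n
    · intro z
      obtain ⟨⟨q, _, n, rfl⟩, hz⟩ := IsLocalization.surj (Submonoid.powers x) z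
      refine ⟨⟨Ideal.Quotient.mk _ (rename Subtype.val q), ⟨_, n, rfl⟩⟩, ?_⟩
      simp only [map_pow, halg, hφ, hΦs, hΦr] at hz ⊢
      rw [← hz, ← hu]
    · intro a b hab
      rw [halg, halg] at hab
      obtain ⟨p, hpab⟩ := Ideal.Quotient.mk_surjective (a - b)
      obtain ⟨n, q, hq⟩ := aux_clear s t hst g' p
      rw [hg', ← hf] at hq
      have hq' := Ideal.Quotient.eq.2 hq
      have hΦp : φ (Ideal.Quotient.mk _ p) = 0 := by rw [hpab, map_sub, hab, sub_self]
      have h1 := congrArg φ hq'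
      rw [map_mul, map_mul, hΦp, mul_zero, hφ, hΦr] at h1
      have hq0 : q = 0 := hinj (by rw [← h1, map_zero])
      rw [hq0, map_zero, map_zero, map_mul, hpab, map_pow] at hq'
      refine ⟨⟨_, n, rfl⟩, ?_⟩
      exact sub_eq_zero.1 (by rw [← mul_sub]; exact hq')
  have hLU : UniqueFactorizationMonoid L :=
    UniqueFactorizationMonoid.of_isLocalization (Submonoid.powers x) L
  exact (UniqueFactorizationMonoid.iff_of_isLocalizationAway_of_prime hp L).2 hLU

open MvPolynomial in
/-- For `d ≥ 3` and any nonnegative integers `a₁, …, a_n`, the ring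
`ℂ[x₁,…,x_d,y₁,…,y_d,w₁,…,w_n]/(x₁y₁ + ⋯ + x_dy_d - w₁^{a₁}⋯w_n^{a_n})`
is a unique factorization domain. (The quotient is a domain since the relation is
irreducible; this is recorded as an instance hypothesis.) -/
theorem stmt_7 (d n : ℕ) (hd : 3 ≤ d) (a : Fin n → ℕ)
    [IsDomain (MvPolynomial ((Fin d ⊕ Fin d) ⊕ Fin n) ℂ ⧸
      Ideal.span {((∑ i : Fin d, X (Sum.inl (Sum.inl i)) * X (Sum.inl (Sum.inr i))) -
        ∏ l : Fin n, X (Sum.inr l) ^ a l :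
        MvPolynomial ((Fin d ⊕ Fin d) ⊕ Fin n) ℂ)})] :
    UniqueFactorizationMonoid (MvPolynomial ((Fin d ⊕ Fin d) ⊕ Fin n) ℂ ⧸
      Ideal.span {((∑ i : Fin d, X (Sum.inl (Sum.inl i)) * X (Sum.inl (Sum.inr i))) -
        ∏ l : Fin n, X (Sum.inr l) ^ a l :
        MvPolynomial ((Fin d ⊕ Fin d) ⊕ Fin n) ℂ)}) := by
  obtain ⟨k, rfl⟩ : ∃ k, d = k + 3 := ⟨d - 3, by omega⟩
  have hF : ∀ i : Fin (k + 2), (i.succ : Fin (k + 3)) ≠ 0 := fun i => Fin.succ_ne_zero i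
  have hF' : ∀ i : Fin (k + 1), (i.succ : Fin (k + 2)) ≠ 0 := fun i => Fin.succ_ne_zero i
  refine aux_ufd (Sum.inl (Sum.inl 0)) (Sum.inl (Sum.inr 0)) (by simp) _
    ((∑ i : Fin (k + 2), X (Sum.inl (Sum.inl i.succ)) * X (Sum.inl (Sum.inr i.succ))) -
        ∏ l : Fin n, X (Sum.inr l) ^ a l) ?_ ?_ ?_ ?_
  · rw [Fin.sum_univ_succ]; ring
  · set h : MvPolynomial ((Fin (k + 3) ⊕ Fin (k + 3)) ⊕ Fin n) ℂ :=
      (∑ i : Fin (k + 1), X (Sum.inl (Sum.inl i.succ.succ)) * X (Sum.inl (Sum.inr i.succ.succ))) -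
        ∏ l : Fin n, X (Sum.inr l) ^ a l with hh
    have e : ((∑ i : Fin (k + 2), X (Sum.inl (Sum.inl i.succ)) * X (Sum.inl (Sum.inr i.succ))) -
        ∏ l : Fin n, X (Sum.inr l) ^ a l : MvPolynomial ((Fin (k + 3) ⊕ Fin (k + 3)) ⊕ Fin n) ℂ)
        = X (Sum.inl (Sum.inl (Fin.succ 0))) * X (Sum.inl (Sum.inr (Fin.succ 0))) + h := by
      rw [Fin.sum_univ_succ, hh]; ring
    rw [e]
    refine irreducible_mul_X_add _ _ _ (X_ne_zero _) (by simp) ?_ ?_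
    · have hs : h ∈ supported ℂ
          {i : (Fin (k + 3) ⊕ Fin (k + 3)) ⊕ Fin n | i ≠ Sum.inl (Sum.inr (Fin.succ 0))} := by
        refine Subalgebra.sub_mem _ (Subalgebra.sum_mem _ fun i _ => Subalgebra.mul_mem _ ?_ ?_)
          (Subalgebra.prod_mem _ fun i _ => Subalgebra.pow_mem _ ?_ _)
        · rw [X_mem_supported]; simp
        · rw [X_mem_supported]
          simp only [Set.mem_setOf_eq, ne_eq, Sum.inl.injEq, Sum.inr.injEq, Fin.succ_inj]
          exact hF' i
        · rw [X_mem_supported]; simp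
      rw [mem_supported] at hs
      intro hv
      exact hs hv rfl
    · rw [(X_prime).irreducible.isRelPrime_iff_not_dvd]
      rintro ⟨c, hc⟩
      have h1 := congrArg (MvPolynomial.eval (Sum.elim (Sum.elim
        (fun i => if i = Fin.succ (Fin.succ 0) then (1 : ℂ) else 0)
        (fun i => if i = Fin.succ (Fin.succ 0) then (2 : ℂ) else 0)) (fun _ => 1))) hc
      rw [hh] at h1
      simp only [map_sub, map_sum, map_mul, map_prod, map_pow, eval_X, Sum.elim_inl, Sum.elim_inr,
        one_pow, Finset.prod_const_one, Fin.succ_inj] at h1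
      rw [if_neg (hF' 0).symm] at h1
      simp at h1
      norm_num at h1
  · refine Subalgebra.sub_mem _ (Subalgebra.sum_mem _ fun i _ => Subalgebra.mul_mem _ ?_ ?_)
      (Subalgebra.prod_mem _ fun i _ => Subalgebra.pow_mem _ ?_ _)
    · rw [X_mem_supported]; simp
    · rw [X_mem_supported]; simp
    · rw [X_mem_supported]; simp
  · simp
end

section
/- Let k be a field and n ≥ 5, and let q ∈ k[x₁, …, x_n] be a nondegenerate quadratic form (char k ≠ 2). Then the quotient ring k[x₁,…,x_n]/(q) is a unique factorization domain. In particular, ℂ[x₁,…,x_d, y₁,…,y_d]/(x₁y₁ + ⋯ + x_dy_d) is a UFD for d ≥ 3. -/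
theorem nagata_aux_s19 {R L : Type*} [CommRing R] [IsDomain R] [IsNoetherianRing R]
    [CommRing L] [IsDomain L] [Algebra R L] {x : R} (hx : Prime x) [IsLocalization.Away x L]
    [UniqueFactorizationMonoid L] : UniqueFactorizationMonoid R := by
  have hinj : Function.Injective (algebraMap R L) :=
    IsLocalization.injective L (powers_le_nonZeroDivisors_of_noZeroDivisors hx.ne_zero)
  refine UniqueFactorizationMonoid.iff_exists_prime_mem_of_isPrime.2 ?_
  intro I hI0 hI
  by_cases hxI : x ∈ I
  · exact ⟨x, hxI, hx⟩
  have hdisj : Disjoint (Submonoid.powers x : Set R) (I : Set R) := by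
    rw [Set.disjoint_left]
    rintro _ ⟨n, rfl⟩ h
    exact hxI (hI.mem_of_pow_mem n h)
  have hJ : (I.map (algebraMap R L)).IsPrime :=
    IsLocalization.isPrime_of_isPrime_disjoint (Submonoid.powers x) L I hI hdisj
  have hJ0 : I.map (algebraMap R L) ≠ ⊥ := by
    rw [Ne, Ideal.map_eq_bot_iff_of_injective hinj]
    exact hI0
  obtain ⟨π, hπJ, hπ⟩ := hJ.exists_mem_prime_of_ne_bot hJ0
  rw [IsLocalization.mem_map_algebraMap_iff (Submonoid.powers x)] at hπJ
  obtain ⟨⟨⟨i, hi⟩, ⟨_, m, rfl⟩⟩, h⟩ := hπJ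
  simp only at h
  have hxu : IsUnit (algebraMap R L x) := IsLocalization.Away.algebraMap_isUnit x
  have hi' : Prime (algebraMap R L i) := by
    rw [← h]
    refine (Associated.prime_iff ?_).1 hπ
    have : IsUnit (algebraMap R L (x ^ m)) := by rw [map_pow]; exact hxu.pow m
    exact ⟨this.unit, rfl⟩
  have hi0 : i ≠ 0 := by rintro rfl; simp at hi'
  obtain ⟨l, r, hr, rfl⟩ := WfDvdMonoid.max_power_factor hi0 hx.irreducible
  have hrI : r ∈ I := (hI.mem_or_mem hi).resolve_left fun h => hxI (hI.mem_of_pow_mem l h)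
  have hr' : Prime (algebraMap R L r) := by
    rw [map_mul, map_pow] at hi'
    refine (Associated.prime_iff ?_).1 hi'
    exact (associated_unit_mul_left _ _ (hxu.pow l))
  refine ⟨r, hrI, right_ne_zero_of_mul hi0, fun h => hI.ne_top (Ideal.eq_top_of_isUnit_mem _ hrI h), ?_⟩
  have key : ∀ a : R, algebraMap R L r ∣ algebraMap R L a → r ∣ a := by
    rintro a ⟨c, hc⟩
    obtain ⟨⟨c', ⟨_, m, rfl⟩⟩, h⟩ := IsLocalization.surj (Submonoid.powers x) c
    simp only at h
    have h2 : a * x ^ m = r * c' := by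
      apply hinj
      rw [map_mul, map_mul, hc, ← h, mul_assoc]
    have h3 : x ^ m ∣ c' := hx.pow_dvd_of_dvd_mul_left _ hr ⟨a, by rw [← h2, mul_comm]⟩
    obtain ⟨d, rfl⟩ := h3
    refine ⟨d, mul_right_cancel₀ (pow_ne_zero m hx.ne_zero) (h2.trans (by ring))⟩
  intro a b hab
  have := (map_dvd (algebraMap R L) hab)
  rw [map_mul] at this
  exact (hr'.dvd_or_dvd this).imp (key a) (key b)


theorem descent_abs {R S : Type*} [CommRing R] [IsDomain R] [IsNoetherianRing R]
    [CommRing S] [IsDomain S] [UniqueFactorizationMonoid S] (j : R →+* S)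
    (τ : S →+* S) (hττ : ∀ s, τ (τ s) = s) (hfix : ∀ s : S, τ s = s → ∃ r, s = j r)
    (hτj : ∀ r, τ (j r) = j r) (hjinj : Function.Injective j)
    (hH : ∀ u : S, u * τ u = 1 → ∃ c : S, IsUnit c ∧ τ c * u = c) :
    UniqueFactorizationMonoid R := by
  have hdvd : ∀ r s : R, j r ∣ j s → r ∣ s := by
    rintro r s ⟨t, ht⟩
    by_cases hr : r = 0
    · subst hr
      rw [map_zero, zero_mul, ← map_zero j] at ht
      rw [hjinj ht]
    · have hjr : j r ≠ 0 := by rw [← map_zero j]; exact hjinj.ne hr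
      obtain ⟨t', rfl⟩ := hfix t (by
        apply mul_left_cancel₀ hjr
        rw [← ht, ← hτj s, ht, map_mul, hτj])
      refine ⟨t', hjinj ?_⟩
      rw [ht, map_mul]
  have hunit : ∀ r, IsUnit (j r) → IsUnit r := by
    intro r hr
    apply isUnit_of_dvd_one
    apply hdvd
    rw [map_one]
    exact hr.dvd
  have hτdvd : ∀ s t : S, s ∣ t → τ s ∣ τ t := fun s t h => map_dvd τ h
  have hprimej : ∀ r, Prime (j r) → Prime r := by
    intro r hr
    refine ⟨fun h => hr.ne_zero (by rw [h, map_zero]), fun h => hr.not_isUnit (h.map j), ?_⟩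
    intro a b hab
    have := map_dvd j hab
    rw [map_mul] at this
    exact (hr.dvd_or_dvd this).imp (hdvd _ _) (hdvd _ _)
  have main : ∀ r : R, r ≠ 0 → ¬ IsUnit r → ∃ p, Prime p ∧ p ∣ r := by
    intro r hr0 hru
    obtain ⟨π, hπi, hπr⟩ := WfDvdMonoid.exists_irreducible_factor
      (a := j r) (fun h => hru (hunit r h)) (by rw [← map_zero j]; exact hjinj.ne hr0)
    have hπ : Prime π := UniqueFactorizationMonoid.irreducible_iff_prime.1 hπi
    have hτπ : Prime (τ π) := by
      let e : S ≃* S :=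
        { toFun := τ, invFun := τ, left_inv := hττ, right_inv := hττ, map_mul' := map_mul τ }
      exact (MulEquiv.prime_iff e).2 hπ
    have hτπr : τ π ∣ j r := by rw [← hτj]; exact hτdvd _ _ hπr
    by_cases has : Associated π (τ π)
    · obtain ⟨u, hu⟩ := has
      have h1 : (u : S) * τ u = 1 := by
        apply mul_left_cancel₀ hπ.ne_zero
        rw [← mul_assoc, hu, ← map_mul, hu, hττ, mul_one]
      obtain ⟨c, hc, hcu⟩ := hH u h1
      obtain ⟨p, hp⟩ := hfix (c * π) (by
        rw [map_mul, ← hu]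
        calc τ c * (π * u) = (τ c * u) * π := by ring
          _ = _ := by rw [hcu])
      have has2 : Associated (c * π) π := associated_unit_mul_left _ _ hc
      refine ⟨p, hprimej p ?_, hdvd _ _ ?_⟩
      · rw [← hp]; exact has2.symm.prime hπ
      · rw [← hp]; exact has2.dvd.trans hπr
    · obtain ⟨p, hp⟩ := hfix (π * τ π) (by rw [map_mul, hττ, mul_comm])
      have hcop : ∀ s, τ s = s → π ∣ s → π * τ π ∣ s := by
        intro s hs h
        obtain ⟨t, ht⟩ := h
        have h' : τ π ∣ π * t := by rw [← ht, ← hs, ht]; exact hτdvd _ _ (dvd_mul_right _ _)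
        rcases hτπ.dvd_or_dvd h' with h' | h'
        · exact absurd (hτπ.irreducible.associated_of_dvd hπ.irreducible h').symm has
        · rw [ht]; exact mul_dvd_mul_left _ h'
      have hp2 : ∀ s, π ∣ j s → p ∣ s := by
        intro s hs
        apply hdvd
        rw [← hp]
        exact hcop _ (hτj s) hs
      refine ⟨p, ⟨?_, ?_, ?_⟩, hp2 _ hπr⟩
      · rintro rfl
        rw [map_zero] at hp
        exact mul_ne_zero hπ.ne_zero hτπ.ne_zero hp
      · intro h
        have := h.map j
        rw [← hp] at this
        exact hπ.not_isUnit (isUnit_of_mul_isUnit_left this)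
      · intro a b hab
        have := map_dvd j hab
        rw [map_mul] at this
        have h3 : π ∣ j p := by rw [← hp]; exact dvd_mul_right _ _
        exact (hπ.dvd_or_dvd (h3.trans this)).imp (hp2 a) (hp2 b)
  have hnoeth : WfDvdMonoid R := inferInstance
  refine { hnoeth with irreducible_iff_prime := ?_ }
  intro r
  refine ⟨fun hr => ?_, fun h => h.irreducible⟩
  obtain ⟨p, hp, hpr⟩ := main r hr.ne_zero hr.not_isUnit
  exact (hp.irreducible.associated_of_dvd hr hpr).prime hp

open QuadraticAlgebra in
/-- Quadratic Galois descent. -/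
theorem descent_aux {k R : Type*} [Field k] [CommRing R] [IsDomain R] [IsNoetherianRing R]
    [Algebra k R]
    (h2 : (2 : k) ≠ 0) (a : k) (hna : ∀ r : k, r ^ 2 ≠ a)
    [IsDomain (QuadraticAlgebra R (algebraMap k R a) 0)]
    [UniqueFactorizationMonoid (QuadraticAlgebra R (algebraMap k R a) 0)]
    (hu : ∀ u : QuadraticAlgebra R (algebraMap k R a) 0, IsUnit u →
      ∃ α β : k, u = ⟨algebraMap k R α, algebraMap k R β⟩) : UniqueFactorizationMonoid R := by
  have h2R : (2 : R) ≠ 0 := by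
    have := (map_ne_zero (algebraMap k R)).2 h2
    rwa [map_ofNat] at this
  refine descent_abs (algebraMap R (QuadraticAlgebra R (algebraMap k R a) 0))
    (starRingEnd _) star_star ?_ ?_ algebraMap_injective ?_
  · intro s hs
    refine ⟨s.re, ?_⟩
    have := congrArg QuadraticAlgebra.im hs
    rw [starRingEnd_apply, QuadraticAlgebra.im_star] at this
    have h0 : s.im = 0 := by
      have : 2 * s.im = 0 := by linear_combination -this
      exact (mul_eq_zero.1 this).resolve_left h2R
    ext
    · rfl
    · exact h0
  · intro r
    ext <;> simp [starRingEnd_apply]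
  · intro u h1
    rw [starRingEnd_apply] at h1
    simp only [starRingEnd_apply]
    obtain ⟨α, β, rfl⟩ := hu u (IsUnit.of_mul_eq_one _ h1)
    by_cases hc : α = -1 ∧ β = 0
    · obtain ⟨rfl, rfl⟩ := hc
      refine ⟨⟨0, 1⟩, ?_, ?_⟩
      · rw [QuadraticAlgebra.isUnit_iff_norm_isUnit, QuadraticAlgebra.norm_def]
        have ha : a ≠ 0 := fun h => hna 0 (by simp [h])
        have := (IsUnit.mk0 a ha).map (algebraMap k R)
        simpa using this
      · ext <;> simp
    · refine ⟨1 + ⟨algebraMap k R α, algebraMap k R β⟩, ?_, ?_⟩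
      · rw [QuadraticAlgebra.isUnit_iff_norm_isUnit, QuadraticAlgebra.norm_def]
        have h0 : (1 + α) * (1 + α) - a * β * β ≠ 0 := by
          intro h
          by_cases hβ : β = 0
          · subst hβ
            have : (1 + α) = 0 := by simpa using h
            exact hc ⟨by linear_combination this, rfl⟩
          · refine hna ((1 + α) / β) ?_
            field_simp
            linear_combination h
        have := (IsUnit.mk0 _ h0).map (algebraMap k R)
        simpa using this
      · rw [star_add, star_one, add_mul, one_mul, mul_comm (star _), h1, add_comm]
open Polynomial in
theorem core_domain {B : Type*} [CommRing B] [IsDomain B] [UniqueFactorizationMonoid B]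
    (p : B) (hp : Prime p) : IsDomain (AdjoinRoot (C X * X - C (C p) : B[X][X])) := by
  have h : Irreducible (C X * X + C (-C p) : B[X][X]) := by
    apply Polynomial.irreducible_C_mul_X_add_C X_ne_zero
    intro d hd1 hd2
    have hd2 : d ∣ C p := by simpa using hd2
    have hdeg : d.natDegree = 0 := by
      have := Polynomial.natDegree_le_of_dvd hd2 (by simpa using hp.ne_zero)
      simpa using this
    rw [natDegree_eq_zero] at hdeg
    obtain ⟨e, rfl⟩ := hdeg
    have := (Polynomial.C_dvd_iff_dvd_coeff _ _).1 hd1 1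
    rw [coeff_X_one] at this
    exact (isUnit_of_dvd_one this).map C
  have h' : Prime (C X * X - C (C p) : B[X][X]) := by
    have := UniqueFactorizationMonoid.irreducible_iff_prime.1 h
    simpa [sub_eq_add_neg] using this
  exact AdjoinRoot.isDomain_of_prime h'

open Polynomial in
theorem core_ufd {B : Type*} [CommRing B] [IsDomain B] [IsNoetherianRing B]
    [UniqueFactorizationMonoid B]
    (p : B) (hp : Prime p) :
    UniqueFactorizationMonoid (AdjoinRoot (C X * X - C (C p) : B[X][X])) := by
  have hdom := core_domain p hp
  set f : B[X][X] := C X * X - C (C p) with hf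
  let x : AdjoinRoot f := AdjoinRoot.of f X
  let y : AdjoinRoot f := AdjoinRoot.root f
  have hxy : x * y = AdjoinRoot.of f (C p) := by
    have : AdjoinRoot.mk f f = 0 := AdjoinRoot.mk_self
    have h2 : AdjoinRoot.mk f (C X * X - C (C p)) = 0 := by rw [← hf]; exact this
    rw [map_sub, map_mul, AdjoinRoot.mk_C, AdjoinRoot.mk_C, AdjoinRoot.mk_X, sub_eq_zero] at h2
    exact h2
  let L := Localization.Away (X : B[X])
  have : IsDomain L := IsLocalization.isDomain_localization
    (powers_le_nonZeroDivisors_of_noZeroDivisors X_ne_zero)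
  have hLinj : Function.Injective (algebraMap B[X] L) :=
    IsLocalization.injective L (powers_le_nonZeroDivisors_of_noZeroDivisors X_ne_zero)
  have : UniqueFactorizationMonoid L := inferInstance
  let φ : AdjoinRoot f →+* L := AdjoinRoot.lift (algebraMap B[X] L)
    (algebraMap B[X] L (C p) * IsLocalization.Away.invSelf (X : B[X])) (by
      have h1 : algebraMap B[X] L X * IsLocalization.Away.invSelf (X : B[X]) = 1 :=
        IsLocalization.Away.mul_invSelf _
      rw [hf]
      simp only [eval₂_sub, eval₂_mul, eval₂_C, eval₂_X]
      linear_combination (algebraMap B[X] L (C p)) * h1)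
  have hφ : ∀ g, φ (AdjoinRoot.of f g) = algebraMap B[X] L g := fun g => AdjoinRoot.lift_of _
  -- primality of x
  have : (Ideal.span {p}).IsPrime := (Ideal.span_singleton_prime hp.ne_zero).2 hp
  let π : B →+* B ⧸ Ideal.span {p} := Ideal.Quotient.mk _
  let i : B[X] →+* B ⧸ Ideal.span {p} := π.comp constantCoeff
  have hip : ∀ c, i c = 0 → x ∣ AdjoinRoot.of f c := by
    intro c hc
    have hc' : c.coeff 0 ∈ Ideal.span {p} := Ideal.Quotient.eq_zero_iff_mem.1 hc
    rw [Ideal.mem_span_singleton] at hc'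
    obtain ⟨e, he⟩ := hc'
    rw [← Polynomial.divX_mul_X_add c, he, map_add, map_mul, map_mul, map_mul, ← hxy]
    refine dvd_add (dvd_mul_left _ _) ?_
    rw [mul_assoc]
    exact dvd_mul_right _ _
  let ψ : AdjoinRoot f →+* (B ⧸ Ideal.span {p})[X] := AdjoinRoot.lift (C.comp i) X (by
      have h0 : π p = 0 := Ideal.Quotient.eq_zero_iff_mem.2 (Ideal.mem_span_singleton_self p)
      rw [hf]
      simp [i, h0])
  have hψ : ∀ s, ψ s = 0 ↔ x ∣ s := by
    intro s
    constructor
    · intro hs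
      obtain ⟨g, rfl⟩ := AdjoinRoot.mk_surjective s
      have h1 : ψ (AdjoinRoot.mk f g) = g.map i := by
        change AdjoinRoot.lift _ _ _ _ = _
        rw [AdjoinRoot.lift_mk, Polynomial.map, ]
      rw [h1] at hs
      rw [g.as_sum_range, map_sum]
      refine Finset.dvd_sum fun m _ => ?_
      rw [← C_mul_X_pow_eq_monomial, map_mul, AdjoinRoot.mk_C]
      refine Dvd.dvd.mul_right (hip _ ?_) _
      rw [← coeff_map, hs, coeff_zero]
    · rintro ⟨t, rfl⟩
      rw [map_mul]
      have : ψ x = 0 := by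
        change AdjoinRoot.lift _ _ _ (AdjoinRoot.of f X) = _
        rw [AdjoinRoot.lift_of]
        simp [i]
      rw [this, zero_mul]
  have hx0 : x ≠ 0 := by
    intro h
    have := hφ X
    rw [show AdjoinRoot.of f X = 0 from h, map_zero, ← map_zero (algebraMap B[X] L)] at this
    exact X_ne_zero (hLinj this).symm
  have hx : Prime x := by
    refine ⟨hx0, ?_, ?_⟩
    · intro h
      have h1 : x ∣ 1 := h.dvd
      rw [← hψ, map_one] at h1
      exact one_ne_zero h1
    · intro a b
      rw [← hψ, ← hψ, ← hψ, map_mul]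
      exact mul_eq_zero.1
  have hnf : ∀ s : AdjoinRoot f, ∃ n : ℕ, ∃ g : B[X], x ^ n * s = AdjoinRoot.of f g := by
    intro s
    obtain ⟨g, rfl⟩ := AdjoinRoot.mk_surjective s
    induction g using Polynomial.induction_on' with
    | add g h hg hh =>
      obtain ⟨n, g', hg⟩ := hg
      obtain ⟨m, h', hh⟩ := hh
      refine ⟨n + m, X ^ m * g' + X ^ n * h', ?_⟩
      rw [map_add, map_add, map_mul, map_mul, ← hg, ← hh, map_pow, map_pow]
      ring
    | monomial m c =>
      refine ⟨m, c * C p ^ m, ?_⟩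
      rw [← C_mul_X_pow_eq_monomial, map_mul, AdjoinRoot.mk_C, map_pow, AdjoinRoot.mk_X,
        map_mul, map_pow, ← hxy]
      ring
  have hφinj : Function.Injective φ := by
    rw [injective_iff_map_eq_zero]
    intro s hs
    obtain ⟨n, g, hg⟩ := hnf s
    have h1 : algebraMap B[X] L g = 0 := by rw [← hφ, ← hg, map_mul, hs, mul_zero]
    rw [← map_zero (algebraMap B[X] L)] at h1
    rw [hLinj h1, map_zero] at hg
    exact (mul_eq_zero.1 hg).resolve_left (pow_ne_zero _ hx0)
  let _ : Algebra (AdjoinRoot f) L := φ.toAlgebra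
  have : IsLocalization.Away x L := by
    refine ⟨?_, ?_, ?_⟩
    · rintro ⟨_, n, rfl⟩
      change IsUnit (φ (x ^ n))
      rw [map_pow, hφ]
      exact (IsLocalization.Away.algebraMap_isUnit _).pow n
    · intro z
      obtain ⟨⟨g, ⟨_, n, rfl⟩⟩, h⟩ := IsLocalization.surj (Submonoid.powers (X : B[X])) z
      refine ⟨⟨AdjoinRoot.of f g, ⟨_, n, rfl⟩⟩, ?_⟩
      change z * φ (x ^ n) = φ (AdjoinRoot.of f g)
      rw [map_pow, hφ, hφ, ← h, map_pow]
    · intro a b h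
      exact ⟨1, by rw [hφinj h]⟩
  have : IsNoetherianRing (AdjoinRoot f) := 
    isNoetherianRing_of_surjective _ _ (AdjoinRoot.mk f) AdjoinRoot.mk_surjective
  exact nagata_aux_s19 (L := L) hx

/-- The quotient by `q` is a factorial domain. -/
def FactQuot {R : Type*} [CommRing R] (q : R) : Prop :=
  IsDomain (R ⧸ Ideal.span {q}) ∧ UniqueFactorizationMonoid (R ⧸ Ideal.span {q})

theorem FactQuot.transfer {R R' : Type*} [CommRing R] [CommRing R'] (e : R ≃+* R') {q : R} {q' : R'}
    (hq : e q = q') (h : FactQuot q') : FactQuot q := by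
  obtain ⟨h1, h2⟩ := h
  let E : (R ⧸ Ideal.span {q}) ≃+* (R' ⧸ Ideal.span {q'}) :=
    Ideal.quotientEquiv _ _ e (by rw [Ideal.map_span, Set.image_singleton]; simp [hq])
  exact ⟨E.toMulEquiv.isDomain _, E.symm.toMulEquiv.uniqueFactorizationMonoid h2⟩

open MvPolynomial in
theorem diag_prime {K : Type*} [Field K] (h2 : (2 : K) ≠ 0) {m : ℕ} (w : Fin (m + 3) → K)
    (hw : ∀ i, w i ≠ 0) : Prime (∑ i, C (w i) * X i ^ 2 : MvPolynomial (Fin (m + 3)) K) := by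
  rw [← MulEquiv.prime_iff (finSuccEquiv K (m + 2)).toMulEquiv]
  set g : MvPolynomial (Fin (m + 2)) K := ∑ i : Fin (m + 2), C (w i.succ) * X i ^ 2 with hg
  have hq : (finSuccEquiv K (m + 2)) (∑ i, C (w i) * X i ^ 2)
      = Polynomial.C (C (w 0)) * (Polynomial.X ^ 2 - Polynomial.C (- C (w 0)⁻¹ * g)) := by
    have hC : ∀ c : K, finSuccEquiv K (m + 2) (C c) = Polynomial.C (C c) := fun c => by
      simp [finSuccEquiv_apply]
    have h1 : (Polynomial.C (C (w 0)) * Polynomial.C (C (w 0)⁻¹) :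
        Polynomial (MvPolynomial (Fin (m + 2)) K)) = 1 := by
      rw [← Polynomial.C_mul, ← C_mul, mul_inv_cancel₀ (hw 0)]; simp
    rw [Fin.sum_univ_succ, map_add, map_sum]
    simp only [map_mul, map_pow, hC, finSuccEquiv_X_zero, finSuccEquiv_X_succ, hg, map_sum, map_neg]
    linear_combination (-∑ x : Fin (m + 2), Polynomial.C (C (w x.succ)) *
      Polynomial.C (X x : MvPolynomial (Fin (m + 2)) K) ^ 2) * h1
  change Prime ((finSuccEquiv K (m + 2)) (∑ i, C (w i) * X i ^ 2))
  rw [hq]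
  have hu : IsUnit (Polynomial.C (C (w 0)) : Polynomial (MvPolynomial (Fin (m + 2)) K)) :=
    ((IsUnit.mk0 _ (hw 0)).map C).map Polynomial.C
  rw [(associated_unit_mul_left _ _ hu).prime_iff, ← UniqueFactorizationMonoid.irreducible_iff_prime]
  set h := - C (w 0)⁻¹ * g with hh
  have hmon : (Polynomial.X ^ 2 - Polynomial.C h).Monic := Polynomial.monic_X_pow_sub_C _ two_ne_zero
  have hdeg : (Polynomial.X ^ 2 - Polynomial.C h).natDegree = 2 := Polynomial.natDegree_X_pow_sub_C
  rw [hmon.irreducible_iff_roots_eq_zero_of_degree_le_three (by rw [hdeg]) (by rw [hdeg]; norm_num),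
    Multiset.eq_zero_iff_forall_notMem]
  intro r hr
  have hr2 := (Polynomial.mem_roots'.1 hr).2
  simp only [Polynomial.IsRoot.def, Polynomial.eval_sub, Polynomial.eval_pow, Polynomial.eval_X,
    Polynomial.eval_C, sub_eq_zero] at hr2
  have hdvd : ∀ i, r ∣ X i := by
    intro i
    have hd : pderiv i g = C (2 * w i.succ) * X i := by
      rw [hg, map_sum, Finset.sum_eq_single i]
      · simp [Derivation.leibniz, Derivation.leibniz_pow]
        rw [show (C 2 : MvPolynomial (Fin (m + 2)) K) = 2 from map_ofNat C 2]
        ring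
      · intro j _ hj
        simp [Derivation.leibniz, Derivation.leibniz_pow, pderiv_X_of_ne hj]
      · simp
    have h3 := congrArg (pderiv i) hr2
    rw [hh, Derivation.leibniz, Derivation.leibniz_pow] at h3
    simp only [map_neg, pderiv_C, hd, smul_eq_mul] at h3
    have h4 : r ∣ C (-((w 0)⁻¹ * (2 * w i.succ))) * X i := by
      refine ⟨2 * pderiv i r, ?_⟩
      rw [map_neg, C_mul]
      linear_combination (exp := 1) -h3
    have hu : IsUnit (C (-((w 0)⁻¹ * (2 * w i.succ))) : MvPolynomial (Fin (m + 2)) K) := by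
      refine (IsUnit.mk0 _ ?_).map C
      exact neg_ne_zero.2 (mul_ne_zero (inv_ne_zero (hw 0)) (mul_ne_zero h2 (hw _)))
    exact (hu.dvd_mul_left).1 h4
  have hru : IsUnit r := by
    obtain ⟨s, hs⟩ := hdvd 0
    rcases (X_prime (R := K) (i := (0 : Fin (m + 2)))).irreducible.isUnit_or_isUnit hs with h | h
    · exact h
    · have h5 : (X 0 : MvPolynomial (Fin (m + 2)) K) ∣ X 1 := by
        rw [hs, h.mul_right_dvd]; exact hdvd 1
      rw [X_dvd_X] at h5
      simp at h5
  have := (hru.pow 2).map (constantCoeff (σ := Fin (m + 2)) (R := K))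
  rw [hr2, hh, hg] at this
  simp at this

open MvPolynomial in
theorem split_fact {K : Type*} [Field K] {m : ℕ}
    (g : MvPolynomial (Fin m) K) (hg : Prime g) :
    FactQuot (X 0 * X 1 + rename (fun i : Fin m => i.succ.succ) g :
      MvPolynomial (Fin (m + 2)) K) := by
  let e : MvPolynomial (Fin (m + 2)) K ≃+* Polynomial (Polynomial (MvPolynomial (Fin m) K)) :=
    (finSuccEquiv K (m + 1)).toRingEquiv.trans
      (Polynomial.mapEquiv (finSuccEquiv K m).toRingEquiv)
  have hC : ∀ (m : ℕ) (c : K), finSuccEquiv K m (C c) = Polynomial.C (C c) := fun m c => by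
      simp [finSuccEquiv_apply]
  have he : e (X 0 * X 1 + rename (fun i : Fin m => i.succ.succ) g)
      = Polynomial.C Polynomial.X * Polynomial.X - Polynomial.C (Polynomial.C (-g)) := by
    have h1 : e (X 0) = Polynomial.X := by
      change Polynomial.mapEquiv _ (finSuccEquiv K (m + 1) (X 0)) = _
      rw [finSuccEquiv_X_zero]
      simp
    have h2 : e (X 1) = Polynomial.C Polynomial.X := by
      have : (1 : Fin (m + 2)) = Fin.succ 0 := rfl
      rw [this]
      simp only [e, RingEquiv.trans_apply]
      change Polynomial.mapEquiv _ (finSuccEquiv K (m + 1) (X (Fin.succ 0))) = _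
      rw [finSuccEquiv_X_succ]
      simp only [Polynomial.mapEquiv_apply, Polynomial.map_C]
      change Polynomial.C (finSuccEquiv K m (X 0)) = _
      rw [finSuccEquiv_X_zero]
    have h3 : e (rename (fun i : Fin m => i.succ.succ) g) = Polynomial.C (Polynomial.C g) := by
      have : (e : _ →+* _).comp (rename (fun i : Fin m => i.succ.succ) :
          MvPolynomial (Fin m) K →ₐ[K] _).toRingHom = Polynomial.C.comp Polynomial.C := by
        apply MvPolynomial.ringHom_ext
        · intro c
          simp only [e]
          change Polynomial.mapEquiv _ (finSuccEquiv K (m + 1) (rename _ (C c))) = _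
          rw [rename_C, hC]
          simp [hC]
        · intro i
          change Polynomial.mapEquiv _ (finSuccEquiv K (m + 1) (rename _ (X i))) = _
          rw [rename_X, finSuccEquiv_X_succ]
          simp only [Polynomial.mapEquiv_apply, Polynomial.map_C]
          change Polynomial.C (finSuccEquiv K m (X i.succ)) = _
          rw [finSuccEquiv_X_succ]
          rfl
      exact DFunLike.congr_fun this g
    rw [map_add, map_mul, h1, h2, h3, map_neg, map_neg]
    ring
  exact FactQuot.transfer e he ⟨core_domain (-g) hg.neg, core_ufd (-g) hg.neg⟩

open MvPolynomial in
theorem iso_fact {K : Type*} [Field K] (h2 : (2 : K) ≠ 0) {m : ℕ} (w : Fin (m + 5) → K)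
    (hw : ∀ i, w i ≠ 0) (ι : K) (hι : w 1 = - w 0 * ι ^ 2) :
    FactQuot (∑ i, C (w i) * X i ^ 2 : MvPolynomial (Fin (m + 5)) K) := by
  have hι0 : ι ≠ 0 := by rintro rfl; exact hw 1 (by simp [hι])
  let f : MvPolynomial (Fin (m + 5)) K →ₐ[K] MvPolynomial (Fin (m + 5)) K :=
    aeval (Fin.cons (C (2 * w 0)⁻¹ * X 0 + C 2⁻¹ * X 1)
      (Fin.cons (C (2 * ι)⁻¹ * X 1 - C (2 * ι * w 0)⁻¹ * X 0) fun i => X i.succ.succ))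
  let g : MvPolynomial (Fin (m + 5)) K →ₐ[K] MvPolynomial (Fin (m + 5)) K :=
    aeval (Fin.cons (C (w 0) * (X 0 - C ι * X 1))
      (Fin.cons (X 0 + C ι * X 1) fun i => X i.succ.succ))
  have hw0 := hw 0
  have f0 : f (X 0) = C (2 * w 0)⁻¹ * X 0 + C 2⁻¹ * X 1 := by simp [f]
  have f1 : f (X 1) = C (2 * ι)⁻¹ * X 1 - C (2 * ι * w 0)⁻¹ * X 0 := by
    rw [show (1 : Fin (m + 5)) = Fin.succ 0 from rfl]; simp only [f, aeval_X, Fin.cons_succ, Fin.cons_zero]; rfl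
  have fs : ∀ i : Fin (m + 3), f (X i.succ.succ) = X i.succ.succ := by
    intro i; simp only [f, aeval_X, Fin.cons_succ]
  have g0 : g (X 0) = C (w 0) * (X 0 - C ι * X 1) := by simp [g]
  have g1 : g (X 1) = X 0 + C ι * X 1 := by
    rw [show (1 : Fin (m + 5)) = Fin.succ 0 from rfl]; simp only [g, aeval_X, Fin.cons_succ, Fin.cons_zero]; rfl
  have gs : ∀ i : Fin (m + 3), g (X i.succ.succ) = X i.succ.succ := by
    intro i; simp only [g, aeval_X, Fin.cons_succ]
  have fC : ∀ c, f (C c) = C c := fun c => by simp [f]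
  have gC : ∀ c, g (C c) = C c := fun c => by simp [g]
  -- scalar identities pushed through `C`
  have e1 : (C (2 * w 0)⁻¹ * C (w 0) : MvPolynomial (Fin (m + 5)) K) = C 2⁻¹ := by
    rw [← C_mul]; congr 1; field_simp
  have e2 : (C 2⁻¹ + C 2⁻¹ : MvPolynomial (Fin (m + 5)) K) = 1 := by
    rw [← C_add, ← C_1]; congr 1; field_simp; norm_num
  have e3 : (C (2 * ι)⁻¹ * C ι : MvPolynomial (Fin (m + 5)) K) = C 2⁻¹ := by
    rw [← C_mul]; congr 1; field_simp
  have e4 : (C (2 * ι * w 0)⁻¹ * C (w 0) : MvPolynomial (Fin (m + 5)) K) = C (2 * ι)⁻¹ := by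
    rw [← C_mul]; congr 1; field_simp
  have e5 : (C (2 * ι * w 0)⁻¹ * C ι : MvPolynomial (Fin (m + 5)) K) = C (2 * w 0)⁻¹ := by
    rw [← C_mul]; congr 1; field_simp
  let e : MvPolynomial (Fin (m + 5)) K ≃ₐ[K] MvPolynomial (Fin (m + 5)) K :=
    AlgEquiv.ofAlgHom f g (by
      ext1 i
      refine Fin.cases ?_ (fun i => Fin.cases ?_ (fun i => ?_) i) i
      · simp only [AlgHom.comp_apply, g0, map_mul, map_sub, fC, f0, f1, AlgHom.id_apply]
        linear_combination X 0 * e1 + (C (w 0) * X 0) * e5 - C (w 0) * X 1 * e3 + X 0 * e2 + X 0 * e1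
      · change f (g (X 1)) = X 1
        simp only [AlgHom.comp_apply, g1, map_add, map_mul, map_sub, fC, f0, f1, AlgHom.id_apply]
        linear_combination X 1 * e3 - X 0 * e5 + X 1 * e2
      · simp only [AlgHom.comp_apply, gs, fs, AlgHom.id_apply]) (by
      ext1 i
      refine Fin.cases ?_ (fun i => Fin.cases ?_ (fun i => ?_) i) i
      · simp only [AlgHom.comp_apply, g0, g1, map_mul, map_add, map_sub, gC, f0, AlgHom.id_apply]
        linear_combination (X 0 - C ι * X 1) * e1 + X 0 * e2
      · change g (f (X 1)) = X 1
        simp only [map_add, map_mul, map_sub, gC, g0, g1, f1]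
        linear_combination -(X 0 - C ι * X 1) * e4 + 2 * X 1 * e3 + X 1 * e2
      · simp only [AlgHom.comp_apply, gs, fs, AlgHom.id_apply])
  have hp := diag_prime h2 (fun i : Fin (m + 3) => w i.succ.succ) (fun i => hw _)
  have hs := split_fact _ hp
  refine FactQuot.transfer e.toRingEquiv ?_ hs
  change e _ = _
  rw [← AlgEquiv.eq_symm_apply]
  change _ = g _
  simp only [map_add, map_sum, map_mul, map_pow, rename_C, rename_X, gC, gs, g0, g1]
  rw [Fin.sum_univ_succ, Fin.sum_univ_succ]
  change C (w 0) * (X 0) ^ 2 + (C (w 1) * (X 1) ^ 2 + _) = _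
  rw [← add_assoc, hι]
  congr 1
  simp only [C_mul, C_neg, C_pow]
  ring

open MvPolynomial in
theorem units_const {K ι : Type*} [Field K] [Fintype ι] (w : ι → K)
    (q : MvPolynomial ι K) (hq : q = ∑ i, C (w i) * X i ^ 2)
    [IsDomain (MvPolynomial ι K ⧸ Ideal.span {q})]
    (u : MvPolynomial ι K ⧸ Ideal.span {q})
    (hu : IsUnit u) : ∃ c : K, u = Ideal.Quotient.mk _ (C c) := by
  let π : MvPolynomial ι K →+* MvPolynomial ι K ⧸ Ideal.span {q} := Ideal.Quotient.mk _
  have hπq : π q = 0 := Ideal.Quotient.eq_zero_iff_mem.2 (Ideal.mem_span_singleton_self q)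
  let F : MvPolynomial ι K →+* Polynomial (MvPolynomial ι K ⧸ Ideal.span {q}) :=
    eval₂Hom (Polynomial.C.comp (π.comp C)) (fun i => Polynomial.X * Polynomial.C (π (X i)))
  have hFq : F q = 0 := by
    have this : ∀ f : MvPolynomial ι K, f = ∑ i, C (w i) * X i ^ 2 →
        F f = Polynomial.X ^ 2 * Polynomial.C (π f) := by
      rintro _ rfl
      simp only [F, map_sum, map_mul, map_pow, coe_eval₂Hom, eval₂_C,
        eval₂_X, Finset.mul_sum, RingHom.comp_apply]
      refine Finset.sum_congr rfl fun i _ => ?_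
      ring
    rw [this q hq, hπq, map_zero, mul_zero]
  let φ := Ideal.Quotient.lift (Ideal.span {q}) F (by
    intro a ha
    obtain ⟨b, rfl⟩ := Ideal.mem_span_singleton.1 ha
    rw [map_mul, hFq, zero_mul])
  have h1 : ∀ g, (φ (π g)).eval 1 = π g := by
    intro g
    have : (Polynomial.evalRingHom 1).comp F = π := by
      apply MvPolynomial.ringHom_ext
      · intro c; simp [F]
      · intro i; simp [F]
    exact DFunLike.congr_fun this g
  have h0 : ∀ g, (φ (π g)).eval 0 = π (C (constantCoeff g)) := by
    intro g
    have : (Polynomial.evalRingHom 0).comp F = (π.comp C).comp constantCoeff := by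
      apply MvPolynomial.ringHom_ext
      · intro c; simp [F]
      · intro i; simp [F]
    exact DFunLike.congr_fun this g
  obtain ⟨s, hs, hs'⟩ := Polynomial.isUnit_iff.1 (hu.map φ)
  obtain ⟨g, hg⟩ := Ideal.Quotient.mk_surjective u
  refine ⟨constantCoeff g, ?_⟩
  have a1 := h1 g
  have a0 := h0 g
  have hg2 : π g = u := hg
  rw [← hg2] at hs'
  rw [← hs', Polynomial.eval_C] at a0 a1
  exact hg2.symm.trans (a1.symm.trans a0)

/-- Ring homs out of a quadratic algebra. -/
def quadLift {R A : Type*} [CommRing R] [CommRing A] {a : R} (f : R →+* A) (u : A)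
    (hu : u * u = f a) : QuadraticAlgebra R a 0 →+* A where
  toFun z := f z.re + f z.im * u
  map_one' := by simp [QuadraticAlgebra.re_one, QuadraticAlgebra.im_one]
  map_zero' := by simp
  map_add' x y := by simp; ring
  map_mul' x y := by
    simp
    linear_combination (-f x.im * f y.im) * hu

theorem quadLift_apply {R A : Type*} [CommRing R] [CommRing A] {a : R} (f : R →+* A) (u : A)
    (hu : u * u = f a) (z : QuadraticAlgebra R a 0) :
    quadLift f u hu z = f z.re + f z.im * u := rfl

theorem quad_eq {R : Type*} [CommRing R] {a : R} (z : QuadraticAlgebra R a 0) :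
    z = algebraMap R _ z.re + algebraMap R _ z.im * ⟨0, 1⟩ := by
  ext <;> simp

theorem quad_omega {R : Type*} [CommRing R] {a : R} :
    (⟨0, 1⟩ : QuadraticAlgebra R a 0) * ⟨0, 1⟩ = algebraMap R _ a := by
  ext <;> simp

theorem quad_hom_ext {R A : Type*} [CommRing R] [CommRing A] {a : R}
    {f g : QuadraticAlgebra R a 0 →+* A} (h1 : ∀ r, f (algebraMap R _ r) = g (algebraMap R _ r))
    (h2 : f ⟨0, 1⟩ = g ⟨0, 1⟩) : f = g := by
  ext z
  rw [quad_eq z]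
  simp only [map_add, map_mul, h1, h2]

open MvPolynomial in
theorem quad_iso {k ι : Type*} [Field k] [Fintype ι] (w : ι → k) (a : k)
    [hF : Fact (∀ r : k, r ^ 2 ≠ a + 0 * r)] :
    ∃ e : QuadraticAlgebra (MvPolynomial ι k ⧸
        Ideal.span {(∑ i, C (w i) * X i ^ 2 : MvPolynomial ι k)}) (algebraMap k _ a) 0 ≃+*
      (MvPolynomial ι (QuadraticAlgebra k a 0) ⧸
        Ideal.span {(∑ i, C (algebraMap k _ (w i)) * X i ^ 2 :
          MvPolynomial ι (QuadraticAlgebra k a 0))}),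
      ∀ α β : k, e ⟨algebraMap k _ α, algebraMap k _ β⟩ = Ideal.Quotient.mk _ (C ⟨α, β⟩) := by
  set K := QuadraticAlgebra k a 0 with hK
  set q : MvPolynomial ι k := ∑ i, C (w i) * X i ^ 2 with hq
  set q' : MvPolynomial ι K := ∑ i, C (algebraMap k K (w i)) * X i ^ 2 with hq'
  let π : MvPolynomial ι k →+* MvPolynomial ι k ⧸ Ideal.span {q} := Ideal.Quotient.mk _
  let π' : MvPolynomial ι K →+* MvPolynomial ι K ⧸ Ideal.span {q'} := Ideal.Quotient.mk _
  have hπq : π q = 0 := Ideal.Quotient.eq_zero_iff_mem.2 (Ideal.mem_span_singleton_self q)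
  have hπq' : π' q' = 0 := Ideal.Quotient.eq_zero_iff_mem.2 (Ideal.mem_span_singleton_self q')
  let S := QuadraticAlgebra (MvPolynomial ι k ⧸ Ideal.span {q}) (algebraMap k _ a) 0
  let j := algebraMap (MvPolynomial ι k ⧸ Ideal.span {q}) S
  have hmap : MvPolynomial.map (algebraMap k K) q = q' := by
    simp [hq, hq']
  let F0 : MvPolynomial ι k ⧸ Ideal.span {q} →+* MvPolynomial ι K ⧸ Ideal.span {q'} :=
    Ideal.Quotient.lift _ (π'.comp (MvPolynomial.map (algebraMap k K))) (by
      intro b hb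
      obtain ⟨c, rfl⟩ := Ideal.mem_span_singleton.1 hb
      rw [RingHom.comp_apply, map_mul, hmap, map_mul, hπq', zero_mul])
  have hF0 : ∀ g, F0 (π g) = π' (MvPolynomial.map (algebraMap k K) g) := fun g => rfl
  have hF0k : ∀ c : k, F0 (algebraMap k _ c) = π' (C (algebraMap k K c)) := by
    intro c
    have := hF0 (C c)
    rw [map_C] at this
    exact this
  have hω : (⟨0, 1⟩ : K) * ⟨0, 1⟩ = algebraMap k K a := by
    exact quad_omega
  let F : S →+* MvPolynomial ι K ⧸ Ideal.span {q'} := quadLift F0 (π' (C ⟨0, 1⟩)) (by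
    rw [hF0k, ← map_mul, ← C_mul, hω])
  let κ : K →+* S := quadLift (j.comp (algebraMap k _)) ⟨0, 1⟩ (by
    exact quad_omega)
  have hκ : ∀ c : k, κ (algebraMap k K c) = j (algebraMap k _ c) := by
    intro c
    change j (algebraMap k _ c) + j (algebraMap k _ 0) * _ = _
    simp
  have hκω : κ ⟨0, 1⟩ = ⟨0, 1⟩ := by
    change j (algebraMap k _ 0) + j (algebraMap k _ 1) * _ = _
    simp
  let G0 : MvPolynomial ι K →+* S := eval₂Hom κ (fun i => j (π (X i)))
  have hG0 : G0.comp (MvPolynomial.map (algebraMap k K)) = j.comp π := by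
    apply MvPolynomial.ringHom_ext
    · intro c
      simp only [G0, RingHom.comp_apply, map_C, coe_eval₂Hom, eval₂_C, hκ]
      rfl
    · intro i
      simp [G0]
  let G : MvPolynomial ι K ⧸ Ideal.span {q'} →+* S := Ideal.Quotient.lift _ G0 (by
      intro b hb
      obtain ⟨c, rfl⟩ := Ideal.mem_span_singleton.1 hb
      have h1 := DFunLike.congr_fun hG0 q
      simp only [RingHom.comp_apply, hmap, hπq, map_zero] at h1
      rw [map_mul, h1, zero_mul])
  have hG : ∀ g, G (π' g) = G0 g := fun g => rfl
  have hFj : ∀ r, F (j r) = F0 r := by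
    intro r
    change F0 r + F0 0 * _ = _
    simp
  have hFω : F ⟨0, 1⟩ = π' (C ⟨0, 1⟩) := by
    change F0 0 + F0 1 * _ = _
    simp
  have hFG : F.comp G = RingHom.id _ := by
    apply Ideal.Quotient.ringHom_ext
    apply MvPolynomial.ringHom_ext
    · intro c
      change F (G0 (C c)) = π' (C c)
      simp only [G0, coe_eval₂Hom, eval₂_C]
      have e1 : κ c = κ (algebraMap k K c.re) + κ (algebraMap k K c.im) * κ ⟨0, 1⟩ := by
        rw [hκ, hκ, hκω]; rfl
      have e2 : c = algebraMap k K c.re + algebraMap k K c.im * ⟨0, 1⟩ := quad_eq c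
      rw [e1, map_add, map_mul, hκ, hκ, hκω, hFj, hFj, hFω, hF0k, hF0k, ← map_mul, ← map_add,
        ← C_mul, ← C_add, ← e2]
    · intro i
      change F (G0 (X i)) = π' (X i)
      simp only [G0, coe_eval₂Hom, eval₂_X, hFj, hF0, map_X]
  have hGF : G.comp F = RingHom.id _ := by
    apply quad_hom_ext
    · intro r
      obtain ⟨g, rfl⟩ := Ideal.Quotient.mk_surjective r
      change G (F (j (π g))) = j (π g)
      rw [hFj, hF0, hG]
      exact DFunLike.congr_fun hG0 g
    · change G (F ⟨0, 1⟩) = ⟨0, 1⟩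
      rw [hFω, hG]
      simp only [G0, coe_eval₂Hom, eval₂_C, hκω]
  refine ⟨RingEquiv.ofRingHom F G hFG hGF, ?_⟩
  intro α β
  change F0 (algebraMap k _ α) + F0 (algebraMap k _ β) * π' (C ⟨0, 1⟩) = π' (C ⟨α, β⟩)
  rw [hF0k, hF0k, ← map_mul, ← map_add, ← C_mul, ← C_add]
  congr 2
  exact (quad_eq (⟨α, β⟩ : QuadraticAlgebra k a 0)).symm

open MvPolynomial in
theorem diag_fact {k : Type*} [Field k] (h2 : (2 : k) ≠ 0) {m : ℕ} (w : Fin (m + 5) → k)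
    (hw : ∀ i, w i ≠ 0) :
    FactQuot (∑ i, C (w i) * X i ^ 2 : MvPolynomial (Fin (m + 5)) k) := by
  set a := - w 1 / w 0 with ha
  have hw0 := hw 0
  by_cases hsq : ∃ r, r ^ 2 = a
  · obtain ⟨r, hr⟩ := hsq
    refine iso_fact h2 w hw r ?_
    rw [hr, ha]; field_simp
  push Not at hsq
  have hF : Fact (∀ r : k, r ^ 2 ≠ a + 0 * r) := ⟨fun r => by simpa using hsq r⟩
  have hinj : Function.Injective (algebraMap k (QuadraticAlgebra k a 0)) :=
    QuadraticAlgebra.algebraMap_injective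
  have hK := iso_fact (K := QuadraticAlgebra k a 0)
    (by intro h; exact h2 (congrArg QuadraticAlgebra.re h))
    (fun i => algebraMap k _ (w i)) (fun i => by
      rw [← map_zero (algebraMap k (QuadraticAlgebra k a 0))]; exact hinj.ne (hw i)) ⟨0, 1⟩ (by
        rw [pow_two, quad_omega, ← map_neg, ← map_mul]
        congr 1
        rw [ha]
        field_simp)
  obtain ⟨hd, hu⟩ := hK
  obtain ⟨e, he⟩ := quad_iso w a
  have hdS := e.toMulEquiv.isDomain _
  have huS := e.symm.toMulEquiv.uniqueFactorizationMonoid hu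
  have hdR : IsDomain (MvPolynomial (Fin (m + 5)) k ⧸
      Ideal.span {(∑ i, C (w i) * X i ^ 2 : MvPolynomial (Fin (m + 5)) k)}) :=
    (QuadraticAlgebra.algebraMap_injective (a := algebraMap k _ a) (b := 0)).isDomain
      (algebraMap _ (QuadraticAlgebra _ _ _))
  refine ⟨hdR, ?_⟩
  refine descent_aux h2 a hsq ?_
  intro u hun
  obtain ⟨c, hc⟩ := units_const _ _ rfl (e u) (hun.map e)
  refine ⟨c.re, c.im, e.injective ?_⟩
  rw [hc, he]

open MvPolynomial in
/-- The quadratic form attached to a matrix. -/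
noncomputable def qf {k ι : Type*} [Field k] [Fintype ι] (A : Matrix ι ι k) : MvPolynomial ι k :=
  ∑ i, ∑ j, C (A i j) * X i * X j

open MvPolynomial in
noncomputable def linSub {k ι κ : Type*} [Field k] [Fintype ι] [Fintype κ] (P : Matrix ι κ k) :
    MvPolynomial ι k →ₐ[k] MvPolynomial κ k :=
  aeval fun i => ∑ j, C (P i j) * X j

open MvPolynomial in
theorem linSub_comp {k ι κ : Type*} [Field k] [Fintype ι] [Fintype κ] [DecidableEq ι]
    (P : Matrix ι κ k) (Q : Matrix κ ι k) (h : P * Q = 1) :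
    (linSub Q).comp (linSub P) = AlgHom.id k _ := by
  apply MvPolynomial.algHom_ext
  intro i
  simp only [linSub, AlgHom.comp_apply, aeval_X, map_sum, map_mul, AlgHom.id_apply, algHom_C,
    algebraMap_eq, Finset.mul_sum]
  rw [Finset.sum_comm]
  have : ∀ l, ∑ j, C (P i j) * (C (Q j l) * X l) = C ((P * Q) i l) * (X l : MvPolynomial ι k) := by
    intro l
    rw [Matrix.mul_apply, map_sum, Finset.sum_mul]
    refine Finset.sum_congr rfl fun j _ => ?_
    rw [C_mul, mul_assoc]
  simp only [this, h, Matrix.one_apply]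
  rw [Finset.sum_eq_single i]
  · simp
  · intro b _ hb
    simp [hb.symm]
  · simp

open MvPolynomial in
theorem linSub_qf {k ι κ : Type*} [Field k] [Fintype ι] [Fintype κ]
    (P : Matrix ι κ k) (A : Matrix ι ι k) :
    linSub P (qf A) = qf (P.transpose * A * P) := by
  simp only [linSub, qf, map_sum, map_mul, algHom_C, algebraMap_eq, aeval_X, Matrix.mul_apply,
    Matrix.transpose_apply, Finset.sum_mul, Finset.mul_sum]
  have e1 : ∀ i, ∑ j, ∑ b, ∑ a, C (A i j) * (C (P i a) * X a) * (C (P j b) * X b) =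
      ∑ a, ∑ b, ∑ j, C (P i a) * C (A i j) * C (P j b) * X a * (X b : MvPolynomial κ k) := by
    intro i
    rw [Finset.sum_comm]
    rw [Finset.sum_congr rfl fun b _ => Finset.sum_comm]
    rw [Finset.sum_comm]
    refine Finset.sum_congr rfl fun a _ => Finset.sum_congr rfl fun b _ =>
      Finset.sum_congr rfl fun j _ => ?_
    ring
  rw [Finset.sum_congr rfl fun i _ => e1 i]
  rw [Finset.sum_comm]
  refine Finset.sum_congr rfl fun a _ => ?_
  rw [Finset.sum_comm]
  refine Finset.sum_congr rfl fun b _ => ?_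
  rw [Finset.sum_comm]

theorem qf_transfer {k ι κ : Type*} [Field k] [Fintype ι] [Fintype κ] [DecidableEq ι]
    [DecidableEq κ] (P : Matrix ι κ k) (Q : Matrix κ ι k) (h : P * Q = 1) (h' : Q * P = 1)
    (A : Matrix ι ι k) (hA : FactQuot (qf (P.transpose * A * P))) : FactQuot (qf A) := by
  let e := AlgEquiv.ofAlgHom (linSub P) (linSub Q) (linSub_comp Q P h') (linSub_comp P Q h)
  exact FactQuot.transfer e.toRingEquiv (linSub_qf P A) hA

open MvPolynomial in
theorem qf_diagonal {k ι : Type*} [Field k] [Fintype ι] [DecidableEq ι] (w : ι → k) :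
    qf (Matrix.diagonal w) = ∑ i, C (w i) * X i ^ 2 := by
  unfold qf
  refine Finset.sum_congr rfl fun i _ => ?_
  rw [Finset.sum_eq_single i]
  · simp; ring
  · intro b _ hb
    simp [Matrix.diagonal_apply_ne _ hb.symm]
  · simp

theorem qf_fact_basis {k ι : Type*} [Field k] [Fintype ι] [DecidableEq ι] (h2 : (2 : k) ≠ 0)
    (A A' : Matrix ι ι k) (hA : A * A' = 1) (N : ℕ) (hN : 5 ≤ N)
    (v : Module.Basis (Fin N) k (ι → k))
    (hv : LinearMap.IsOrthoᵢ (Matrix.toBilin' A) v) : FactQuot (qf A) := by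
  obtain ⟨m, rfl⟩ : ∃ m, N = m + 5 := ⟨_, (Nat.sub_add_cancel hN).symm⟩
  let b := Pi.basisFun k ι
  have h1 : b.toMatrix v * v.toMatrix b = 1 := b.toMatrix_mul_toMatrix_flip v
  have h1' : v.toMatrix b * b.toMatrix v = 1 := v.toMatrix_mul_toMatrix_flip b
  refine qf_transfer _ _ h1 h1' A ?_
  have hD : (b.toMatrix v).transpose * A * b.toMatrix v =
      Matrix.diagonal fun i => Matrix.toBilin' A (v i) (v i) := by
    have := LinearMap.BilinForm.toMatrix_mul_basis_toMatrix b v (Matrix.toBilin' A)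
    rw [LinearMap.BilinForm.toMatrix_basisFun, LinearMap.BilinForm.toMatrix'_toBilin'] at this
    rw [this]
    ext i j
    rw [LinearMap.BilinForm.toMatrix_apply]
    by_cases hij : i = j
    · subst hij; simp
    · rw [Matrix.diagonal_apply_ne _ hij]
      exact hv hij
  have hinv : (b.toMatrix v).transpose * A * b.toMatrix v *
      (v.toMatrix b * A' * (v.toMatrix b).transpose) = 1 := by
    calc _ = (b.toMatrix v).transpose * (A * (b.toMatrix v * v.toMatrix b) * A') *
          (v.toMatrix b).transpose := by simp only [Matrix.mul_assoc]
      _ = 1 := by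
        rw [h1, Matrix.mul_one, hA, Matrix.mul_one, ← Matrix.transpose_mul, h1',
          Matrix.transpose_one]
  rw [hD] at hinv ⊢
  rw [qf_diagonal]
  refine diag_fact h2 _ fun i hi => ?_
  have := congrFun (congrFun hinv i) i
  rw [Matrix.diagonal_mul, hi, zero_mul, Matrix.one_apply_eq] at this
  exact zero_ne_one this

theorem qf_fact {k ι : Type*} [Field k] [Fintype ι] [DecidableEq ι] (h2 : (2 : k) ≠ 0)
    (hc : 5 ≤ Fintype.card ι) (A A' : Matrix ι ι k) (hs : A.transpose = A) (hA : A * A' = 1) :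
    FactQuot (qf A) := by
  have : Invertible (2 : k) := invertibleOfNonzero h2
  have hsymm : LinearMap.IsSymm (Matrix.toBilin' A) := by
    constructor
    intro x y
    simp only [Matrix.toBilin'_apply, RingHom.id_apply]
    rw [Finset.sum_comm]
    refine Finset.sum_congr rfl fun i _ => Finset.sum_congr rfl fun j _ => ?_
    have : A j i = A i j := congrFun (congrFun hs i) j
    rw [this]; ring
  obtain ⟨v, hv⟩ := LinearMap.BilinForm.exists_orthogonal_basis hsymm
  exact qf_fact_basis h2 A A' hA _ (by rw [Module.finrank_fintype_fun_eq_card]; exact hc) v hv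

open MvPolynomial in
theorem qf_hyp (d : ℕ) :
    qf (Matrix.fromBlocks 0 ((1 / 2 : ℂ) • 1) ((1 / 2 : ℂ) • 1) 0 :
      Matrix (Fin d ⊕ Fin d) (Fin d ⊕ Fin d) ℂ) = ∑ i : Fin d, X (Sum.inl i) * X (Sum.inr i) := by
  unfold qf
  simp only [Fintype.sum_sum_type, Matrix.fromBlocks_apply₁₁, Matrix.fromBlocks_apply₁₂,
    Matrix.fromBlocks_apply₂₁, Matrix.fromBlocks_apply₂₂, Matrix.zero_apply, C_0, zero_mul,
    Finset.sum_const_zero, zero_add, add_zero, Matrix.smul_apply, Matrix.one_apply]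
  rw [← Finset.sum_add_distrib]
  refine Finset.sum_congr rfl fun i _ => ?_
  rw [Finset.sum_eq_single i (by intro b _ hb; simp [hb.symm]) (by simp),
    Finset.sum_eq_single i (by intro b _ hb; simp [hb.symm]) (by simp)]
  simp only [if_true, smul_eq_mul, mul_one]
  have : (C (1 / 2 : ℂ) : MvPolynomial (Fin d ⊕ Fin d) ℂ) + C (1 / 2) = 1 := by
    rw [← C_add, ← C_1]; congr 1; norm_num
  linear_combination (X (Sum.inl i) * X (Sum.inr i)) * this


open Matrix MvPolynomial in
/-- Klein–Nagata: for a field `k` with `char k ≠ 2` and `n ≥ 5`, the quotient of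
`k[x₁,…,xₙ]` by a nondegenerate quadratic form `q = ∑ aᵢⱼ xᵢ xⱼ` (symmetric invertible
coefficient matrix) is a unique factorization domain. In particular
`ℂ[x₁,…,x_d,y₁,…,y_d]/(x₁y₁ + ⋯ + x_dy_d)` is a UFD for `d ≥ 3`. (That the quotients
are domains is recorded as instance hypotheses.) -/
theorem stmt_19 :
    (∀ (k : Type) [Field k], ringChar k ≠ 2 → ∀ n : ℕ, 5 ≤ n →
      ∀ A : Matrix (Fin n) (Fin n) k, Aᵀ = A → IsUnit A.det →
      ∀ [IsDomain (MvPolynomial (Fin n) k ⧸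
          Ideal.span {(∑ i : Fin n, ∑ j : Fin n, C (A i j) * X i * X j :
            MvPolynomial (Fin n) k)})],
        UniqueFactorizationMonoid (MvPolynomial (Fin n) k ⧸
          Ideal.span {(∑ i : Fin n, ∑ j : Fin n, C (A i j) * X i * X j :
            MvPolynomial (Fin n) k)})) ∧
    (∀ d : ℕ, 3 ≤ d →
      ∀ [IsDomain (MvPolynomial (Fin d ⊕ Fin d) ℂ ⧸
          Ideal.span {(∑ i : Fin d, X (Sum.inl i) * X (Sum.inr i) :
            MvPolynomial (Fin d ⊕ Fin d) ℂ)})],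
        UniqueFactorizationMonoid (MvPolynomial (Fin d ⊕ Fin d) ℂ ⧸
          Ideal.span {(∑ i : Fin d, X (Sum.inl i) * X (Sum.inr i) :
            MvPolynomial (Fin d ⊕ Fin d) ℂ)})) := by
  refine ⟨?_, ?_⟩
  · intro k _ hk n hn A hs hA _
    exact (qf_fact (Ring.two_ne_zero hk) (by simpa using hn) A A⁻¹ hs
      (Matrix.mul_nonsing_inv A hA)).2
  · intro d hd _
    have h := qf_fact (k := ℂ) two_ne_zero (by simp; omega)
      (Matrix.fromBlocks 0 ((1 / 2 : ℂ) • 1) ((1 / 2 : ℂ) • 1) 0 :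
        Matrix (Fin d ⊕ Fin d) (Fin d ⊕ Fin d) ℂ)
      (Matrix.fromBlocks 0 ((2 : ℂ) • 1) ((2 : ℂ) • 1) 0)
      (by simp [Matrix.fromBlocks_transpose])
      (by simp [Matrix.fromBlocks_multiply, smul_smul])
    rw [qf_hyp] at h
    exact h.2
end
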